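/- Let n ≥ 0, l ≥ 1, p ≥ 2, q a prime power ≥ 2. Let M be a family of Meshalkin sequences of length p in PG(n-1,q): tuples (a_1,…,a_p) of subspaces with a_1 + ⋯ + a_p = V and dim a_1 + ⋯ + dim a_p = n. Suppose that for each k ∈ {1,…,p-1} the family M_k = {a_k : a ∈ M} contains no chain of length l. Then Σ_{a ∈ M} 1/([n; r(a)]_q · q^{s_2(r(a))}) ≤ l^{p-1}, where r(a) = (dim a_1,…,dim a_p) and s_2(α) = Σ_{i<j} α_i α_j. -/

import Mathlib

open Finset

/-- The `q`-factorial `n!_q = (q^n - 1)(q^(n-1) - 1) ⋯ (q - 1)`. -/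
def qFact (q n : ℕ) : ℕ := ∏ i ∈ Finset.range n, (q ^ (i + 1) - 1)

/-- The Gaussian multinomial coefficient `[n; α_1, …, α_p]_q = n!_q / (α_1!_q ⋯ α_p!_q)`. -/
noncomputable def gaussMultinomial (q n : ℕ) {p : ℕ} (α : Fin p → ℕ) : ℚ :=
  (qFact q n : ℚ) / ∏ i, (qFact q (α i) : ℚ)

/-- The second elementary symmetric function `s_2(α) = ∑_{i<j} α_i α_j`. -/
def s2 {p : ℕ} (α : Fin p → ℕ) : ℕ :=
  ∑ i, ∑ j ∈ Finset.univ.filter (fun j : Fin p => i < j), α i * α j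

/-- A family is `l`-chain-free if it contains no chain of length `l`, i.e. no `l + 1`
distinct pairwise comparable members. -/
def ChainFree {X : Type*} [PartialOrder X] (l : ℕ) (A : Set X) : Prop :=
  ¬ ∃ c : Fin (l + 1) → X, StrictMono c ∧ ∀ i, c i ∈ A

open Module

/-- The order of `GL m` over a field with `q` elements. -/
def glOrder (q m : ℕ) : ℕ := ∏ i : Fin m, (q ^ m - q ^ (i : ℕ))

/-- The span of the vectors `b s, …, b (s + t - 1)`. -/
def blockSpan (F : Type*) {V : Type*} [Field F] [AddCommGroup V] [Module F V] {n : ℕ}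
    (b : Fin n → V) (s t : ℕ) : Submodule F V :=
  Submodule.span F (b '' {j | s ≤ (j : ℕ) ∧ (j : ℕ) < s + t})

/-- The sum of the entries of `r` that precede position `k`. -/
def prefixSum {p : ℕ} (r : Fin p → ℕ) (k : Fin p) : ℕ :=
  ∑ i : Fin (k : ℕ), r (Fin.castLE k.2.le i)

/-- The members of `a` are spanned by consecutive blocks of `b`. -/
def IsAdapted (F : Type*) {V : Type*} [Field F] [AddCommGroup V] [Module F V] {n p : ℕ}
    (b : Fin n → V) (a : Fin p → Submodule F V) : Prop :=
  ∀ k, a k = blockSpan F b (prefixSum (fun i => finrank F (a i)) k) (finrank F (a k))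

theorem qFact_pos {q : ℕ} (hq : 2 ≤ q) (n : ℕ) : 0 < qFact q n := by
  refine Finset.prod_pos fun i _ => ?_
  have := Nat.one_lt_pow (Nat.succ_ne_zero i) hq
  exact Nat.sub_pos_of_lt this

theorem glOrder_eq (q m : ℕ) : glOrder q m = q ^ (m.choose 2) * qFact q m := by
  have h : glOrder q m = ∏ i ∈ Finset.range m, (q ^ i * (q ^ (m - 1 - i + 1) - 1)) := by
    rw [glOrder, Fin.prod_univ_eq_prod_range (fun i => q ^ m - q ^ i)]
    refine Finset.prod_congr rfl fun i hi => ?_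
    have hi := Finset.mem_range.1 hi
    rw [Nat.mul_sub, ← pow_add, mul_one]
    congr 2
    omega
  rw [h, Finset.prod_mul_distrib, Finset.prod_pow_eq_pow_sum, Finset.sum_range_id,
    Nat.choose_two_right, qFact, Finset.prod_range_reflect (fun i => q ^ (i + 1) - 1)]

theorem s2_succ {p : ℕ} (r : Fin (p + 1) → ℕ) :
    s2 r = r 0 * ∑ i : Fin p, r i.succ + s2 (fun i : Fin p => r i.succ) := by
  simp only [s2, Finset.sum_filter, Fin.sum_univ_succ, Finset.mul_sum]
  simp

theorem choose_two_sum {p : ℕ} (r : Fin p → ℕ) :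
    (∑ i, r i).choose 2 = ∑ i, (r i).choose 2 + s2 r := by
  induction p with
  | zero => simp [s2]
  | succ p ih =>
    rw [s2_succ, Fin.sum_univ_succ, Fin.sum_univ_succ, Nat.add_choose_eq]
    simp only [Finset.Nat.antidiagonal_succ, Finset.Nat.antidiagonal_zero]
    simp [ih]
    ring

/-- `[n; r]_q q^(s_2(r))` is the ratio of the order of `GL n` to that of its block-diagonal
subgroup of type `r`. -/
theorem one_div_gaussMultinomial {q : ℕ} (hq : 2 ≤ q) {p : ℕ} (r : Fin p → ℕ) :
    1 / (gaussMultinomial q (∑ i, r i) r * (q : ℚ) ^ s2 r) =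
      (∏ i, (glOrder q (r i) : ℚ)) / glOrder q (∑ i, r i) := by
  have hpos : ∀ m, (qFact q m : ℚ) ≠ 0 := fun m => by exact_mod_cast (qFact_pos hq m).ne'
  have hq0 : (q : ℚ) ≠ 0 := by exact_mod_cast (by omega : q ≠ 0)
  have hprod : ∏ i, (qFact q (r i) : ℚ) ≠ 0 := Finset.prod_ne_zero_iff.2 fun i _ => hpos _
  simp only [glOrder_eq, gaussMultinomial, choose_two_sum, pow_add, Nat.cast_mul, Nat.cast_pow,
    Finset.prod_mul_distrib, Finset.prod_pow_eq_pow_sum]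
  have := hpos (∑ i, r i)
  field_simp

/-- A set of tuples has at most `∏ c k` members if, after fixing the entries before position `k`,
at most `c k` values remain possible at position `k`. -/
theorem card_le_prod_of_branching {X : Type*} [DecidableEq X] {m : ℕ} (S : Finset (Fin m → X))
    (c : Fin m → ℕ)
    (h : ∀ k, ∀ a ∈ S, ∀ T : Finset X, (∀ x ∈ T, ∃ a' ∈ S, (∀ i < k, a' i = a i) ∧ a' k = x) →
      #T ≤ c k) :
    #S ≤ ∏ k, c k := by
  induction m with
  | zero => simpa using Finset.card_le_one.2 fun a _ b _ => Subsingleton.elim a b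
  | succ m ih =>
    rcases S.eq_empty_or_nonempty with rfl | ⟨a₀, ha₀⟩
    · simp
    rw [Fin.prod_univ_succ, mul_comm]
    have h0 : #(S.image (fun a => a 0)) ≤ c 0 := by
      refine h 0 a₀ ha₀ _ fun x hx => ?_
      obtain ⟨a, ha, rfl⟩ := Finset.mem_image.1 hx
      exact ⟨a, ha, fun i hi => absurd hi (Fin.not_lt_zero i), rfl⟩
    refine (Finset.card_le_mul_card_image (f := fun a => a 0) S (∏ k : Fin m, c k.succ) ?_).trans
      (Nat.mul_le_mul_left _ h0)
    intro x _
    have hinj : Set.InjOn (Fin.tail : (Fin (m + 1) → X) → Fin m → X)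
        ({a ∈ S | a 0 = x} : Finset _) := by
      intro a ha b hb hab
      simp only [Finset.coe_filter, Set.mem_ofPred_eq] at ha hb
      rw [← Fin.cons_self_tail a, ← Fin.cons_self_tail b, hab, ha.2, hb.2]
    rw [← Finset.card_image_of_injOn hinj]
    refine ih _ _ fun k a ha T hT => ?_
    obtain ⟨a, haS, rfl⟩ := Finset.mem_image.1 ha
    rw [Finset.mem_filter] at haS
    refine h k.succ a haS.1 T fun y hy => ?_
    obtain ⟨a', ha', hlt, hk⟩ := hT y hy
    obtain ⟨a', haS', rfl⟩ := Finset.mem_image.1 ha'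
    rw [Finset.mem_filter] at haS'
    refine ⟨a', haS'.1, fun i hi => ?_, hk⟩
    cases i using Fin.cases with
    | zero => rw [haS'.2, haS.2]
    | succ i => exact hlt i (Fin.succ_lt_succ_iff.1 hi)

section

variable {F V : Type*} [Field F] [AddCommGroup V] [Module F V]

theorem ChainFree.card_le [FiniteDimensional F V] {l : ℕ} {A : Set (Submodule F V)}
    (hA : ChainFree l A) (T : Finset (Submodule F V)) (hT : ∀ x ∈ T, x ∈ A)
    (hchain : ∀ x ∈ T, ∀ y ∈ T, x ≤ y ∨ y ≤ x) : #T ≤ l := by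
  classical
  by_contra! hlt
  have hinj : Set.InjOn (fun x : Submodule F V => finrank F x) T := by
    intro x hx y hy hxy
    rcases hchain x hx y hy with h | h
    · exact Submodule.eq_of_le_of_finrank_eq h hxy
    · exact (Submodule.eq_of_le_of_finrank_eq h hxy.symm).symm
  have hcard : l + 1 ≤ #(T.image fun x : Submodule F V => finrank F x) := by
    rwa [Finset.card_image_of_injOn hinj]
  let f := Finset.orderEmbOfCardLe _ hcard
  have hf : ∀ i, ∃ x ∈ T, finrank F x = f i := fun i =>
    Finset.mem_image.1 (Finset.orderEmbOfCardLe_mem _ hcard i)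
  choose c hcT hc using hf
  refine hA ⟨c, fun i j hij => ?_, fun i => hT _ (hcT i)⟩
  have hlt : finrank F (c i) < finrank F (c j) := by
    rw [hc, hc]
    exact f.strictMono hij
  rcases hchain _ (hcT i) _ (hcT j) with h | h
  · exact lt_of_le_of_ne h fun he =>
      hlt.ne (congrArg (fun x : Submodule F V => finrank F x) he)
  · exact absurd (Submodule.finrank_mono h) hlt.not_ge

theorem blockSpan_mono {n : ℕ} (b : Fin n → V) (s : ℕ) {t t' : ℕ} (h : t ≤ t') :
    blockSpan F b s t ≤ blockSpan F b s t' :=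
  Submodule.span_mono (Set.image_mono fun _ hj => ⟨hj.1, hj.2.trans_le (by omega)⟩)

theorem finrank_blockSpan_le {n : ℕ} (b : Fin n → V) (s t : ℕ) :
    finrank F (blockSpan F b s t) ≤ t := by
  classical
  have h : (b '' {j | s ≤ (j : ℕ) ∧ (j : ℕ) < s + t}) =
      ((Finset.univ.filter fun j : Fin n => s ≤ (j : ℕ) ∧ (j : ℕ) < s + t).image b :
        Finset V) := by
    simp
  rw [blockSpan, h]
  refine (finrank_span_finset_le_card _).trans (Finset.card_image_le.trans ?_)
  rw [← Finset.card_map Fin.valEmbedding]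
  refine (Finset.card_le_card (t := Finset.Ico s (s + t)) fun x hx => ?_).trans (by simp)
  obtain ⟨j, hj, rfl⟩ := Finset.mem_map.1 hx
  simpa using hj

theorem prefixSum_congr {p : ℕ} {r r' : Fin p → ℕ} {k : Fin p} (h : ∀ i < k, r i = r' i) :
    prefixSum r k = prefixSum r' k :=
  Finset.sum_congr rfl fun i _ => h _ i.2

theorem prefixSum_last {p : ℕ} (r : Fin p → ℕ) (k : Fin p) (hk : (k : ℕ) + 1 = p) :
    prefixSum r k + r k = ∑ i, r i := by
  obtain ⟨k, hlt⟩ := k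
  obtain rfl : k + 1 = p := hk
  rw [Fin.sum_univ_castSucc]
  rfl

theorem card_filter_isAdapted_le [FiniteDimensional F V] {n l p : ℕ} (b : Fin n → V)
    (S : Finset (Fin p → Submodule F V)) (hS : ∀ a ∈ S, IsAdapted F b a)
    (hsum : ∀ a ∈ S, ∑ i, finrank F (a i) = n)
    (hcf : ∀ k : Fin p, (k : ℕ) + 1 < p →
      ChainFree l {b : Submodule F V | ∃ a ∈ S, a k = b}) :
    #S ≤ l ^ (p - 1) := by
  classical
  have hbound : #S ≤ ∏ k : Fin p, if (k : ℕ) + 1 < p then l else 1 := by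
    refine card_le_prod_of_branching S _ fun k a ha T hT => ?_
    have hT' : ∀ x ∈ T, ∃ a' ∈ S, a' k = x ∧
        prefixSum (fun i => finrank F (a' i)) k = prefixSum (fun i => finrank F (a i)) k ∧
        x = blockSpan F b (prefixSum (fun i => finrank F (a i)) k) (finrank F x) := by
      intro x hx
      obtain ⟨a', ha', hlt, rfl⟩ := hT x hx
      have hp : prefixSum (fun i => finrank F (a' i)) k =
          prefixSum (fun i => finrank F (a i)) k :=
        prefixSum_congr fun i hi => by rw [hlt i hi]
      refine ⟨a', ha', rfl, hp, ?_⟩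
      rw [← hp]
      exact hS a' ha' k
    split_ifs with hk
    · refine (hcf k hk).card_le T (fun x hx => ?_) fun x hx y hy => ?_
      · obtain ⟨a', ha', rfl, -⟩ := hT' x hx
        exact ⟨a', ha', rfl⟩
      · obtain ⟨-, -, -, -, hx⟩ := hT' x hx
        obtain ⟨-, -, -, -, hy⟩ := hT' y hy
        rw [hx, hy]
        exact (le_total _ _).imp (blockSpan_mono b _) (blockSpan_mono b _)
    · have hk : (k : ℕ) + 1 = p := by omega
      refine Finset.card_le_one.2 fun x hx y hy => ?_
      obtain ⟨a', ha', hxk, hx, hx'⟩ := hT' x hx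
      obtain ⟨a'', ha'', hyk, hy, hy'⟩ := hT' y hy
      have h1 := prefixSum_last (fun i => finrank F (a' i)) k hk
      have h2 := prefixSum_last (fun i => finrank F (a'' i)) k hk
      have h3 := hsum a' ha'
      have h4 := hsum a'' ha''
      rw [hxk] at h1
      rw [hyk] at h2
      rw [hx', hy', show finrank F x = finrank F y by omega]
  refine hbound.trans (le_of_eq ?_)
  cases p with
  | zero => simp
  | succ p => simp [Fin.prod_univ_castSucc]

theorem prod_glOrder_le_card_isAdapted [Fintype F] [FiniteDimensional F V] {n p : ℕ}
    (hn : finrank F V = n) (a : Fin p → Submodule F V) (htop : ⨆ i, a i = ⊤)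
    (hsum : ∑ i, finrank F (a i) = n) :
    ∏ i, glOrder (Fintype.card F) (finrank F (a i)) ≤
      Nat.card {b : Fin n → V // LinearIndependent F b ∧ IsAdapted F b a} := by
  have : Finite V := Module.finite_of_finite F
  let e : (Σ i : Fin p, Fin (finrank F (a i))) ≃ Fin n :=
    finSigmaFinEquiv.trans (finCongr hsum)
  have he : ∀ x, (e x : ℕ) = prefixSum (fun i => finrank F (a i)) x.1 + x.2 := fun x =>
    finSigmaFinEquiv_apply x
  let f (v : ∀ i, {s : Fin (finrank F (a i)) → a i // LinearIndependent F s}) (j : Fin n) : V :=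
    (v (e.symm j).1).1 (e.symm j).2
  have hfe : ∀ v i j, f v (e ⟨i, j⟩) = (v i).1 j := fun v i j => by
    simp only [f]
    rw [e.symm_apply_apply]
  have hle : ∀ v k, a k ≤
      blockSpan F (f v) (prefixSum (fun i => finrank F (a i)) k) (finrank F (a k)) := by
    intro v k
    have hspan := (v k).2.span_eq_top_of_card_eq_finrank' (by simp)
    have := congrArg (Submodule.map (a k).subtype) hspan
    rw [Submodule.map_span, Submodule.map_top, Submodule.range_subtype] at this
    refine this.symm.le.trans (Submodule.span_mono ?_)
    rintro _ ⟨_, ⟨j, rfl⟩, rfl⟩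
    refine ⟨e ⟨k, j⟩, ?_, hfe v k j⟩
    simp [he]
  have hadapted : ∀ v, IsAdapted F (f v) a := fun v k =>
    Submodule.eq_of_le_of_finrank_le (hle v k) (finrank_blockSpan_le _ _ _)
  have hli : ∀ v, LinearIndependent F (f v) := by
    intro v
    refine linearIndependent_of_top_le_span_of_card_eq_finrank ?_ (by simp [hn])
    rw [← htop]
    exact iSup_le fun k => (hle v k).trans (Submodule.span_mono (Set.image_subset_range _ _))
  have hcard : ∏ i, glOrder (Fintype.card F) (finrank F (a i)) =
      Nat.card (∀ i, {s : Fin (finrank F (a i)) → a i // LinearIndependent F s}) := by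
    rw [Nat.card_pi]
    exact Finset.prod_congr rfl fun i _ => (card_linearIndependent le_rfl).symm
  rw [hcard]
  refine Nat.card_le_card_of_injective (fun v => ⟨f v, hli v, hadapted v⟩) fun v w hvw => ?_
  have hvw : f v = f w := congrArg Subtype.val hvw
  funext i
  ext j
  rw [← hfe, ← hfe, hvw]

end

/-- Beck–Zaslavsky Meshalkin theorem for projective geometries, LYM form: for a family
`M` of Meshalkin sequences of length `p ≥ 2` in `PG(n-1,q)` whose `k`-th coordinate
families for `k < p` contain no chain of length `l`,
`∑_{a ∈ M} 1/([n; r(a)]_q · q^(s_2(r(a)))) ≤ l^(p-1)`. -/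
theorem meshalkin_projective_lym (q n l p : ℕ) (hl : 1 ≤ l) (hp : 2 ≤ p)
    (F : Type*) [Field F] [Fintype F] (hq : Fintype.card F = q)
    (V : Type*) [AddCommGroup V] [Module F V] [FiniteDimensional F V]
    (hn : Module.finrank F V = n)
    (M : Finset (Fin p → Submodule F V))
    (hmesh : ∀ a ∈ M, (⨆ i, a i) = ⊤ ∧ ∑ i, Module.finrank F (a i) = n)
    (hcf : ∀ k : Fin p, (k : ℕ) + 1 < p →
      ChainFree l {b : Submodule F V | ∃ a ∈ M, a k = b}) :
    ∑ a ∈ M, 1 / (gaussMultinomial q n (fun i => Module.finrank F (a i)) *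
        (q : ℚ) ^ (s2 (fun i => Module.finrank F (a i)))) ≤ (l : ℚ) ^ (p - 1) := by
  classical
  have hV : Finite V := Module.finite_of_finite F
  have := Fintype.ofFinite V
  have hq2 : 2 ≤ q := hq ▸ Fintype.one_lt_card
  let B : Finset (Fin n → V) := Finset.univ.filter fun b => LinearIndependent F b
  have hB : #B = glOrder q n := by
    have h := card_linearIndependent (K := F) (V := V) hn.ge
    rw [Nat.card_eq_fintype_card, Fintype.card_subtype, hn, hq] at h
    exact h
  have hcount : ∑ a ∈ M, ∏ i, glOrder q (finrank F (a i)) ≤ glOrder q n * l ^ (p - 1) := by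
    calc ∑ a ∈ M, ∏ i, glOrder q (finrank F (a i))
        ≤ ∑ a ∈ M, #(B.bipartiteAbove (fun a b => IsAdapted F b a) a) := by
          refine Finset.sum_le_sum fun a ha => ?_
          have h := prod_glOrder_le_card_isAdapted hn a (hmesh a ha).1 (hmesh a ha).2
          rw [Nat.card_eq_fintype_card, Fintype.card_subtype, hq] at h
          rwa [Finset.bipartiteAbove, Finset.filter_filter]
      _ = ∑ b ∈ B, #(M.bipartiteBelow (fun a b => IsAdapted F b a) b) :=
          Finset.sum_card_bipartiteAbove_eq_sum_card_bipartiteBelow _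
      _ ≤ ∑ b ∈ B, l ^ (p - 1) := by
          refine Finset.sum_le_sum fun b _ => ?_
          refine card_filter_isAdapted_le b _ (fun a ha => (Finset.mem_filter.1 ha).2)
            (fun a ha => (hmesh a (Finset.mem_filter.1 ha).1).2) fun k hk hc => hcf k hk ?_
          obtain ⟨c, hmono, hc⟩ := hc
          refine ⟨c, hmono, fun i => ?_⟩
          obtain ⟨a, ha, hak⟩ := hc i
          exact ⟨a, (Finset.mem_filter.1 ha).1, hak⟩
      _ = glOrder q n * l ^ (p - 1) := by rw [Finset.sum_const, hB, smul_eq_mul]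
  have hpos : (0 : ℚ) < glOrder q n := by
    rw [glOrder_eq]
    exact_mod_cast Nat.mul_pos (pow_pos (by omega) _) (qFact_pos hq2 n)
  have hterm : ∀ a ∈ M, 1 / (gaussMultinomial q n (fun i => finrank F (a i)) *
      (q : ℚ) ^ (s2 (fun i => finrank F (a i)))) =
      (∏ i, (glOrder q (finrank F (a i)) : ℚ)) / glOrder q n := by
    intro a ha
    have h := one_div_gaussMultinomial hq2 fun i => finrank F (a i)
    rwa [(hmesh a ha).2] at h
  rw [Finset.sum_congr rfl hterm, ← Finset.sum_div, div_le_iff₀ hpos, mul_comm]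
  exact_mod_cast hcount
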